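/- arXiv:2004.09058 — 2 statements merged into one kernel-verified Lean document; each statement's English description precedes it below -/
import Mathlib

section
/- Let f : ℝⁿ → ℝ be bounded below by κ_f (i.e., f(x) ≥ κ_f for all x), let (x_k)_{k∈ℕ} be a sequence in ℝⁿ with f(x_{k+1}) ≤ f(x_k) for all k, let (s_k) be a sequence in ℝⁿ, let c > 0, and let S = { k ∈ ℕ : f(x_k) − f(x_{k+1}) ≥ c ‖s_k‖² } be the set of successful indices. Then for every ε > 0 the set { k ∈ S : ‖s_k‖ ≥ ε } is finite. -/
/-- If `f` is bounded below, nonincreasing along the iterates `x_k`, and on the set `S`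
of successful indices the decrease satisfies `f(x_k) − f(x_{k+1}) ≥ c ‖s_k‖²` with
`c > 0`, then for every `ε > 0` only finitely many successful indices have `‖s_k‖ ≥ ε`. -/
theorem successful_steps_with_large_norm_finite {n : ℕ}
    (f : EuclideanSpace ℝ (Fin n) → ℝ) (κf : ℝ) (hbdd : ∀ x, κf ≤ f x)
    (x : ℕ → EuclideanSpace ℝ (Fin n)) (hmono : ∀ k, f (x (k + 1)) ≤ f (x k))
    (s : ℕ → EuclideanSpace ℝ (Fin n)) (c : ℝ) (hc : 0 < c)
    (S : Set ℕ) (hS : S = {k : ℕ | f (x k) - f (x (k + 1)) ≥ c * ‖s k‖ ^ 2}) :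
    ∀ ε : ℝ, 0 < ε → {k : ℕ | k ∈ S ∧ ε ≤ ‖s k‖}.Finite := by
  intro ε hε
  have hlim := tendsto_atTop_ciInf (antitone_nat_of_succ_le (f := fun k => f (x k)) hmono)
    ⟨κf, by rintro _ ⟨k, rfl⟩; exact hbdd (x k)⟩
  have hdiff := hlim.sub (hlim.comp (Filter.tendsto_add_atTop_nat 1))
  rw [sub_self] at hdiff
  have hsmall := hdiff.eventually_lt_const (show 0 < c * ε ^ 2 by positivity)
  rw [← Nat.cofinite_eq_atTop] at hsmall
  refine (Filter.eventually_cofinite.mp hsmall).subset ?_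
  rintro k ⟨hk, hεk⟩
  rw [hS] at hk
  have hsq : c * ε ^ 2 ≤ c * ‖s k‖ ^ 2 := by gcongr
  exact not_lt.mpr (hsq.trans hk)
end

section
/- Let f : ℝⁿ → ℝ be Lipschitz continuous with constant L ≥ 0, let c ≥ 0, let x* ∈ ℝⁿ and let d ∈ ℝⁿ be a unit vector. Suppose (x_k) is a sequence with x_k → x*, (α_k) is a sequence of positive reals with α_k → 0, (d_k) is a sequence of unit vectors with d_k → d, and f(x_k + α_k d_k) − f(x_k) ≥ −c α_k² for all k. Then the Clarke generalized directional derivative satisfies f°(x*; d) := limsup_{y → x*, t → 0⁺} ( f(y + t d) − f(y) ) / t ≥ 0. -/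
open Filter

open scoped Topology NNReal

section DifferenceQuotient

variable {E : Type*} [NormedAddCommGroup E] [NormedSpace ℝ E] {f : E → ℝ} {L : ℝ≥0}

/-- The difference quotients of an `L`-Lipschitz function in direction `d` are at most `L * ‖d‖`. -/
lemma LipschitzWith.differenceQuotient_le (hf : LipschitzWith L f) (y d : E) {t : ℝ}
    (ht : 0 < t) : (f (y + t • d) - f y) / t ≤ L * ‖d‖ := by
  rw [div_le_iff₀ ht]
  have h := (le_abs_self _).trans (hf.dist_le_mul (y + t • d) y)
  rw [dist_eq_norm, add_sub_cancel_left, norm_smul, Real.norm_of_nonneg ht.le] at h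
  linarith

/-- Changing the direction of a difference quotient of an `L`-Lipschitz function from `e` to `d`
changes its value by at most `L * ‖e - d‖`. -/
lemma LipschitzWith.differenceQuotient_sub_le (hf : LipschitzWith L f) (y d e : E) {t : ℝ}
    (ht : 0 < t) :
    (f (y + t • e) - f y) / t - L * ‖e - d‖ ≤ (f (y + t • d) - f y) / t := by
  rw [sub_le_iff_le_add', ← sub_le_iff_le_add, ← sub_div, sub_sub_sub_cancel_right]
  simpa [add_assoc, ← smul_add] using hf.differenceQuotient_le (y + t • d) (e - d) ht

end DifferenceQuotient

/-- If `f` is Lipschitz, `x_k → x*`, `α_k → 0⁺`, the unit directions `d_k` converge to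
the unit direction `d`, and `f(x_k + α_k d_k) − f(x_k) ≥ −c α_k²` for all `k` with
`c ≥ 0`, then the Clarke generalized directional derivative
`f°(x*; d) = limsup_{y → x*, t → 0⁺} (f(y + t d) − f(y)) / t` is nonnegative. -/
theorem clarke_derivative_nonneg {n : ℕ}
    (f : EuclideanSpace ℝ (Fin n) → ℝ) (L : NNReal) (hf : LipschitzWith L f)
    (c : ℝ) (hc : 0 ≤ c)
    (xStar d : EuclideanSpace ℝ (Fin n)) (hd : ‖d‖ = 1)
    (x : ℕ → EuclideanSpace ℝ (Fin n)) (hx : Tendsto x atTop (nhds xStar))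
    (α : ℕ → ℝ) (hαpos : ∀ k, 0 < α k) (hα : Tendsto α atTop (nhds 0))
    (dseq : ℕ → EuclideanSpace ℝ (Fin n)) (hdseq : ∀ k, ‖dseq k‖ = 1)
    (hdlim : Tendsto dseq atTop (nhds d))
    (hineq : ∀ k, f (x k + α k • dseq k) - f (x k) ≥ -c * (α k) ^ 2) :
    0 ≤ Filter.limsup
      (fun p : EuclideanSpace ℝ (Fin n) × ℝ => (f (p.1 + p.2 • d) - f p.1) / p.2)
      ((nhds xStar) ×ˢ (nhdsWithin 0 (Set.Ioi 0))) := by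
  have hlim : Tendsto (fun k => (x k, α k)) atTop (𝓝 xStar ×ˢ 𝓝[>] 0) :=
    hx.prodMk (tendsto_nhdsWithin_iff.2 ⟨hα, .of_forall hαpos⟩)
  have hbdd : IsBoundedUnder (· ≤ ·) (𝓝 xStar ×ˢ 𝓝[>] 0)
      (fun p : EuclideanSpace ℝ (Fin n) × ℝ => (f (p.1 + p.2 • d) - f p.1) / p.2) := by
    refine isBoundedUnder_of_eventually_le (a := L * ‖d‖) ?_
    filter_upwards [tendsto_snd.eventually self_mem_nhdsWithin] with p hp
    exact hf.differenceQuotient_le p.1 d hp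
  have hlower : Tendsto (fun k => -c * α k - L * ‖dseq k - d‖) atTop (𝓝 0) := by
    simpa using (hα.const_mul (-c)).sub ((hdlim.sub_const d).norm.const_mul (L : ℝ))
  refine le_of_forall_lt_imp_le_of_dense fun b hb => ?_
  refine le_limsup_of_frequently_le (hlim.frequently (Eventually.frequently ?_)) hbdd
  filter_upwards [hlower.eventually_const_lt hb] with k hk
  have hquot : -c * α k ≤ (f (x k + α k • dseq k) - f (x k)) / α k := by
    rw [le_div_iff₀ (hαpos k)]
    linarith [hineq k]
  linarith [hf.differenceQuotient_sub_le (x k) d (dseq k) (hαpos k)]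
end
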